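/- Let k be an algebraically closed field of characteristic coprime to 6, let C = {q = 0} be a plane quartic, and let ℓ = {u₀x + v₀y + w₀z = 0} be a simple inflection line of C. Then the curves {H(q) = 0} and {K(q) = 0} in the dual plane meet transversally at the point (u₀,v₀,w₀): both H(q) and K(q) vanish at (u₀,v₀,w₀) and the gradient vectors ∇H(q)(u₀,v₀,w₀) and ∇K(q)(u₀,v₀,w₀) are linearly independent over k. -/

import Mathlib

open MvPolynomial

noncomputable section

/-- The classical invariant `S` of a binary quartic form with coefficients `f 0, …, f 4`. -/
def Sinv {R : Type*} [CommRing R] (f : Fin 5 → R) : R :=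
  12 * f 0 * f 4 - 3 * f 1 * f 3 + f 2 ^ 2

/-- The classical invariant `T` of a binary quartic form with coefficients `f 0, …, f 4`. -/
def Tinv {R : Type*} [CommRing R] (f : Fin 5 → R) : R :=
  72 * f 0 * f 2 * f 4 - 27 * f 0 * f 3 ^ 2 - 27 * f 1 ^ 2 * f 4
    + 9 * f 1 * f 2 * f 3 - 2 * f 2 ^ 3

/-- The binary quartic form `f₀ y⁴ + f₁ y³z + f₂ y²z² + f₃ yz³ + f₄ z⁴`. -/
def binQuartic {R : Type*} [CommRing R] (f : Fin 5 → R) : MvPolynomial (Fin 2) R :=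
  ∑ i : Fin 5, C (f i) * X 0 ^ (4 - (i : ℕ)) * X 1 ^ (i : ℕ)

/-- The `i`-th coefficient of a binary quartic form: coefficient of `y^(4-i) z^i`. -/
def binCoeff {R : Type*} [CommRing R] (g : MvPolynomial (Fin 2) R) (i : Fin 5) : R :=
  coeff (Finsupp.single 0 (4 - (i : ℕ)) + Finsupp.single 1 (i : ℕ)) g

/-- The substitution `g(y,z) = q(-v·y - w·z, u·y, u·z)`, a binary quartic form in `y, z` with
coefficients in `R[u,v,w]`. -/
def gsub {R : Type*} [CommRing R] (q : MvPolynomial (Fin 3) R) :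
    MvPolynomial (Fin 2) (MvPolynomial (Fin 3) R) :=
  aeval
    (![(C (- X 1) * X 0 - C (X 2) * X 1 : MvPolynomial (Fin 2) (MvPolynomial (Fin 3) R)),
       C (X 0) * X 0, C (X 0) * X 1]) q

/-- `u⁴ · H(q)`, the invariant `S` of `g(y,z) = q(-vy-wz, uy, uz)`; the harmonic quartic `H(q)`
is the form determined by `u⁴ · H(q) = SG q`. -/
def SG {R : Type*} [CommRing R] (q : MvPolynomial (Fin 3) R) : MvPolynomial (Fin 3) R :=
  Sinv (fun i => binCoeff (gsub q) i)

/-- `u⁶ · K(q)`, the invariant `T` of `g(y,z) = q(-vy-wz, uy, uz)`; the harmonic sextic `K(q)`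
is the form determined by `u⁶ · K(q) = TG q`. -/
def TG {R : Type*} [CommRing R] (q : MvPolynomial (Fin 3) R) : MvPolynomial (Fin 3) R :=
  Tinv (fun i => binCoeff (gsub q) i)

/-- dot product of two vectors in `R³`. -/
def dot3 {R : Type*} [CommRing R] (d a : Fin 3 → R) : R :=
  d 0 * a 0 + d 1 * a 1 + d 2 * a 2

/-- restriction of a ternary form to the parameterized line `(y,z) ↦ y·a + z·b`. -/
def restrictLine {R : Type*} [CommRing R] (q : MvPolynomial (Fin 3) R) (a b : Fin 3 → R) :
    MvPolynomial (Fin 2) R :=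
  aeval (fun i => C (a i) * X 0 + C (b i) * X 1) q

/-- A binary quartic form vanishes identically or has a root of multiplicity at least `3`:
`f = L³·M` with `L ≠ 0` linear and `M` linear (possibly zero). -/
def HasTripleRoot {R : Type*} [CommRing R] (f : MvPolynomial (Fin 2) R) : Prop :=
  ∃ L M : MvPolynomial (Fin 2) R,
    L.IsHomogeneous 1 ∧ M.IsHomogeneous 1 ∧ L ≠ 0 ∧ f = L ^ 3 * M

/-- The line with dual coordinates `d` is an inflection line of the quartic `{q = 0}`. -/
def IsInflectionLine {k : Type*} [Field k] (q : MvPolynomial (Fin 3) k) (d : Fin 3 → k) :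
    Prop :=
  d ≠ 0 ∧ ∃ a b : Fin 3 → k, LinearIndependent k ![a, b] ∧
    dot3 d a = 0 ∧ dot3 d b = 0 ∧ HasTripleRoot (restrictLine q a b)

/-- The line with dual coordinates `d` is a simple inflection line of `{q = 0}` with
inflection point `p`. -/
def IsSimpleInflectionLineAt {k : Type*} [Field k] (q : MvPolynomial (Fin 3) k)
    (d p : Fin 3 → k) : Prop :=
  d ≠ 0 ∧ ∃ (a b : Fin 3 → k) (s t : k), LinearIndependent k ![a, b] ∧
    dot3 d a = 0 ∧ dot3 d b = 0 ∧ (s, t) ≠ (0, 0) ∧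
    (∀ i, p i = s * a i + t * b i) ∧
    eval p q = 0 ∧ (∃ i, eval p (pderiv i q) ≠ 0) ∧
    ∃ L M : MvPolynomial (Fin 2) k, L.IsHomogeneous 1 ∧ M.IsHomogeneous 1 ∧
      LinearIndependent k ![L, M] ∧
      restrictLine q a b = L ^ 3 * M ∧ eval ![s, t] L = 0

/-- The line with dual coordinates `d` is a hyperinflection line of `{q = 0}` with
hyperinflection point `p`. -/
def IsHyperinflectionLineAt {k : Type*} [Field k] (q : MvPolynomial (Fin 3) k)
    (d p : Fin 3 → k) : Prop :=
  d ≠ 0 ∧ ∃ (a b : Fin 3 → k) (s t : k), LinearIndependent k ![a, b] ∧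
    dot3 d a = 0 ∧ dot3 d b = 0 ∧ (s, t) ≠ (0, 0) ∧
    (∀ i, p i = s * a i + t * b i) ∧
    eval p q = 0 ∧ (∃ i, eval p (pderiv i q) ≠ 0) ∧
    ∃ (c : k) (L : MvPolynomial (Fin 2) k), c ≠ 0 ∧ L.IsHomogeneous 1 ∧ L ≠ 0 ∧
      restrictLine q a b = C c * L ^ 4 ∧ eval ![s, t] L = 0

/-- The pairing `⟨·,·⟩` between quartic forms in `x,y,z` and quartic forms in `u,v,w`:
`⟨x^i y^j z^k, u^i v^j w^k⟩ = i!j!k!/2`. -/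
def pairQ {R : Type*} [CommRing R] (q h : MvPolynomial (Fin 3) R) : R :=
  ∑ m ∈ q.support,
    (((m 0).factorial * (m 1).factorial * (m 2).factorial / 2 : ℕ) : R)
      * coeff m q * coeff m h

/-- The action of `Σ c_{ξη} ξ ∂_η ∈ 𝔤𝔩₃(R)` on polynomials. -/
def lieAct {R : Type*} [CommRing R] (c : Fin 3 → Fin 3 → R)
    (q : MvPolynomial (Fin 3) R) : MvPolynomial (Fin 3) R :=
  ∑ ξ : Fin 3, ∑ η : Fin 3, C (c ξ η) * (X ξ * pderiv η q)

/-- substitution of variables by the linear change of coordinates `M`: `q(M·(x,y,z)ᵗ)`. -/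
def substM {R : Type*} [CommRing R] (M : Matrix (Fin 3) (Fin 3) R)
    (q : MvPolynomial (Fin 3) R) : MvPolynomial (Fin 3) R :=
  aeval (fun i => ∑ j : Fin 3, C (M i j) * X j) q

/-- The quartic form `q_ε = (x−y)⁴ + (x−z)⁴ + (y−εz)⁴ − (x⁴ + y⁴ + z⁴)`. -/
def qeps {k : Type*} [CommRing k] (ε : k) : MvPolynomial (Fin 3) k :=
  (X 0 - X 1) ^ 4 + (X 0 - X 2) ^ 4 + (X 1 - C ε * X 2) ^ 4
    - (X 0 ^ 4 + X 1 ^ 4 + X 2 ^ 4)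

section Helpers

variable {k : Type*} [Field k]

/-- Restriction of a ternary form to a parameterized line over a `k`-algebra. -/
def rl {R : Type*} [CommRing R] [Algebra k R] (q : MvPolynomial (Fin 3) k) (a b : Fin 3 → R) :
    MvPolynomial (Fin 2) R :=
  aeval (fun i => C (a i) * X 0 + C (b i) * X 1) q

lemma binary_eq_sum {R : Type*} [CommRing R] (n : ℕ) (g : MvPolynomial (Fin 2) R)
    (hg : g.IsHomogeneous n) :
    g = ∑ i ∈ Finset.range (n + 1),
      C (coeff (Finsupp.single 0 (n - i) + Finsupp.single 1 i) g) * X 0 ^ (n - i) * X 1 ^ i := by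
  have key : ∀ i, (C (coeff (Finsupp.single 0 (n - i) + Finsupp.single 1 i) g) * X 0 ^ (n - i)
      * X 1 ^ i : MvPolynomial (Fin 2) R) =
      monomial (Finsupp.single 0 (n - i) + Finsupp.single 1 i)
        (coeff (Finsupp.single 0 (n - i) + Finsupp.single 1 i) g) := by
    intro i
    rw [X_pow_eq_monomial, X_pow_eq_monomial, C_mul_monomial, monomial_mul]
    simp
  simp only [key]
  ext m
  rw [coeff_sum]
  simp only [coeff_monomial]
  by_cases hm : m 0 + m 1 = n
  · rw [Finset.sum_eq_single (m 1)]
    · have : (Finsupp.single 0 (n - m 1) + Finsupp.single 1 (m 1) : Fin 2 →₀ ℕ) = m := by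
        ext j
        fin_cases j <;> simp <;> omega
      rw [this]; simp
    · intro b _ hb
      rw [if_neg]
      intro h
      apply hb
      rw [← h]; simp
    · intro h
      exfalso; apply h; simp; omega
  · rw [Finset.sum_eq_zero]
    · apply hg.coeff_eq_zero
      rw [Finsupp.degree_eq_sum]
      simpa [Fin.sum_univ_two] using hm
    · intro i hi
      rw [if_neg]
      intro h
      apply hm
      rw [← h]
      simp at hi ⊢
      omega

lemma binQuartic_expand {R : Type*} [CommRing R] (f : Fin 5 → R) :
    binQuartic f = C (f 0) * X 0 ^ 4 + C (f 1) * X 0 ^ 3 * X 1 + C (f 2) * X 0 ^ 2 * X 1 ^ 2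
      + C (f 3) * X 0 * X 1 ^ 3 + C (f 4) * X 1 ^ 4 := by
  simp [binQuartic, Fin.sum_univ_succ, Fin.succ]
  ring

lemma eq_binQuartic {R : Type*} [CommRing R] (g : MvPolynomial (Fin 2) R)
    (hg : g.IsHomogeneous 4) : g = binQuartic (binCoeff g) := by
  conv_lhs => rw [binary_eq_sum 4 g hg]
  rw [binQuartic, ← Fin.sum_univ_eq_sum_range
    (fun i => C (coeff (Finsupp.single 0 (4 - i) + Finsupp.single 1 i) g) * X 0 ^ (4 - i) *
      (X 1 : MvPolynomial (Fin 2) R) ^ i)]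
  rfl

lemma linear_eq {R : Type*} [CommRing R] (g : MvPolynomial (Fin 2) R)
    (hg : g.IsHomogeneous 1) : ∃ m n : R, g = C m * X 0 + C n * X 1 := by
  have h := binary_eq_sum 1 g hg
  simp only [Finset.sum_range_succ, Finset.sum_range_zero, zero_add, Nat.sub_zero, Nat.sub_self,
    pow_zero, pow_one, mul_one] at h
  exact ⟨_, _, h⟩

lemma binCoeff_binQuartic {R : Type*} [CommRing R] (f : Fin 5 → R) (i : Fin 5) :
    binCoeff (binQuartic f) i = f i := by
  have key : ∀ j : Fin 5, (C (f j) * X 0 ^ (4 - (j : ℕ)) * X 1 ^ (j : ℕ) :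
      MvPolynomial (Fin 2) R) =
      monomial (Finsupp.single 0 (4 - (j : ℕ)) + Finsupp.single 1 (j : ℕ)) (f j) := by
    intro i
    rw [X_pow_eq_monomial, X_pow_eq_monomial, C_mul_monomial, monomial_mul]
    simp
  rw [binCoeff, binQuartic, coeff_sum, Finset.sum_eq_single i]
  · rw [key, coeff_monomial, if_pos rfl]
  · intro j _ hj
    rw [key, coeff_monomial, if_neg]
    intro h
    apply hj
    have := DFunLike.congr_fun h 1
    simp at this
    exact Fin.ext this
  · simp

lemma rl_homog {R : Type*} [CommRing R] [Algebra k R] (q : MvPolynomial (Fin 3) k)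
    (hq : q.IsHomogeneous 4) (a b : Fin 3 → R) : (rl q a b).IsHomogeneous 4 := by
  have h := hq.aeval (R := k) (fun i => C (a i) * X 0 + C (b i) * X 1 :
    Fin 3 → MvPolynomial (Fin 2) R) (n := 1) (fun i => by
      apply IsHomogeneous.add
      · simpa using (isHomogeneous_C (Fin 2) (a i)).mul (isHomogeneous_X R (0 : Fin 2))
      · simpa using (isHomogeneous_C (Fin 2) (b i)).mul (isHomogeneous_X R (1 : Fin 2)))
  simpa [rl] using h

lemma map_rl {R R' : Type*} [CommRing R] [Algebra k R] [CommRing R'] [Algebra k R']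
    (φ : R →ₐ[k] R') (q : MvPolynomial (Fin 3) k) (a b : Fin 3 → R) :
    map (φ : R →+* R') (rl q a b) = rl q (fun i => φ (a i)) (fun i => φ (b i)) := by
  have : ((mapAlgHom (σ := Fin 2) φ).comp
      (aeval (fun i => C (a i) * X 0 + C (b i) * X 1 : Fin 3 → MvPolynomial (Fin 2) R)))
      = aeval (fun i => C (φ (a i)) * X 0 + C (φ (b i)) * X 1) := by
    ext i : 1
    simp
  exact DFunLike.congr_fun this q

lemma binCoeff_map {R R' : Type*} [CommRing R] [CommRing R']
    (φ : R →+* R') (g : MvPolynomial (Fin 2) R) (i : Fin 5) :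
    binCoeff (map φ g) i = φ (binCoeff g i) := by
  simp [binCoeff, coeff_map]

lemma rl_comp {R : Type*} [CommRing R] [Algebra k R] (q : MvPolynomial (Fin 3) k)
    (A B : Fin 3 → R) (a1 a2 b1 b2 : R) :
    rl q (fun i => a1 * A i + a2 * B i) (fun i => b1 * A i + b2 * B i) =
      aeval ![C a1 * X 0 + C b1 * X 1, C a2 * X 0 + C b2 * X 1] (rl q A B) := by
  have : ((aeval (R := R) (S₁ := MvPolynomial (Fin 2) R)
        ![C a1 * X 0 + C b1 * X 1, C a2 * X 0 + C b2 * X 1]).restrictScalars k).comp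
      (aeval (fun i => C (A i) * X 0 + C (B i) * X 1 : Fin 3 → MvPolynomial (Fin 2) R))
      = aeval (fun i => C (a1 * A i + a2 * B i) * X 0 + C (b1 * A i + b2 * B i) * X 1) := by
    ext i : 1
    simp [algebraMap_eq]
    ring
  exact (DFunLike.congr_fun this q).symm

/-- coefficients of the substituted quartic -/
def subCoeff {R : Type*} [CommRing R] (f : Fin 5 → R) (a c b d : R) : Fin 5 → R :=
  ![f 0 * a ^ 4 + f 1 * a ^ 3 * c + f 2 * a ^ 2 * c ^ 2 + f 3 * a * c ^ 3 + f 4 * c ^ 4,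
    f 0 * (4 * a ^ 3 * b) + f 1 * (3 * a ^ 2 * b * c + a ^ 3 * d)
      + f 2 * (2 * a * b * c ^ 2 + 2 * a ^ 2 * c * d)
      + f 3 * (b * c ^ 3 + 3 * a * c ^ 2 * d) + f 4 * (4 * c ^ 3 * d),
    f 0 * (6 * a ^ 2 * b ^ 2) + f 1 * (3 * a * b ^ 2 * c + 3 * a ^ 2 * b * d)
      + f 2 * (b ^ 2 * c ^ 2 + 4 * a * b * c * d + a ^ 2 * d ^ 2)
      + f 3 * (3 * b * c ^ 2 * d + 3 * a * c * d ^ 2) + f 4 * (6 * c ^ 2 * d ^ 2),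
    f 0 * (4 * a * b ^ 3) + f 1 * (b ^ 3 * c + 3 * a * b ^ 2 * d)
      + f 2 * (2 * b ^ 2 * c * d + 2 * a * b * d ^ 2)
      + f 3 * (3 * b * c * d ^ 2 + a * d ^ 3) + f 4 * (4 * c * d ^ 3),
    f 0 * b ^ 4 + f 1 * b ^ 3 * d + f 2 * b ^ 2 * d ^ 2 + f 3 * b * d ^ 3 + f 4 * d ^ 4]

lemma aeval_binQuartic {R : Type*} [CommRing R] (f : Fin 5 → R) (a c b d : R) :
    aeval ![C a * X 0 + C b * X 1, C c * X 0 + C d * X 1] (binQuartic f) =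
      binQuartic (subCoeff f a c b d) := by
  rw [binQuartic_expand, binQuartic_expand]
  have h2 : (C (2 : R) : MvPolynomial (Fin 2) R) = 2 := map_ofNat C 2
  have h3 : (C (3 : R) : MvPolynomial (Fin 2) R) = 3 := map_ofNat C 3
  have h4 : (C (4 : R) : MvPolynomial (Fin 2) R) = 4 := map_ofNat C 4
  have h6 : (C (6 : R) : MvPolynomial (Fin 2) R) = 6 := map_ofNat C 6
  simp [subCoeff, algebraMap_eq, h2, h3, h4, h6]
  ring

lemma Sinv_sub {R : Type*} [CommRing R] (f : Fin 5 → R) (a c b d : R) :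
    Sinv (subCoeff f a c b d) = (a * d - b * c) ^ 4 * Sinv f := by
  simp [Sinv, subCoeff]
  ring

lemma Tinv_sub {R : Type*} [CommRing R] (f : Fin 5 → R) (a c b d : R) :
    Tinv (subCoeff f a c b d) = (a * d - b * c) ^ 6 * Tinv f := by
  simp [Tinv, subCoeff]
  ring

lemma binCoeff_comp {R : Type*} [CommRing R] [Algebra k R] (q : MvPolynomial (Fin 3) k)
    (hq : q.IsHomogeneous 4) (A B : Fin 3 → R) (a1 a2 b1 b2 : R) :
    binCoeff (rl q (fun i => a1 * A i + a2 * B i) (fun i => b1 * A i + b2 * B i)) =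
      subCoeff (binCoeff (rl q A B)) a1 a2 b1 b2 := by
  rw [rl_comp, eq_binQuartic (rl q A B) (rl_homog q hq A B), aeval_binQuartic]
  ext i
  rw [binCoeff_binQuartic]
  congr 1
  ext i
  rw [binCoeff_binQuartic]

/-- cross product -/
def crs {R : Type*} [CommRing R] (a b : Fin 3 → R) : Fin 3 → R :=
  ![a 1 * b 2 - a 2 * b 1, a 2 * b 0 - a 0 * b 2, a 0 * b 1 - a 1 * b 0]

lemma gsub_eq (q : MvPolynomial (Fin 3) k) :
    gsub q = rl q ![-X 1, X 0, 0] (![-X 2, 0, X 0] : Fin 3 → MvPolynomial (Fin 3) k) := by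
  have h : (![(C (- X 1) * X 0 - C (X 2) * X 1 : MvPolynomial (Fin 2) (MvPolynomial (Fin 3) k)),
       C (X 0) * X 0, C (X 0) * X 1]) = fun i =>
       C ((![-X 1, X 0, 0] : Fin 3 → MvPolynomial (Fin 3) k) i) * X 0 +
       C ((![-X 2, 0, X 0] : Fin 3 → MvPolynomial (Fin 3) k) i) * X 1 := by
    ext i : 1
    fin_cases i <;> simp [sub_eq_add_neg]
    ring
  unfold gsub rl
  rw [h]

lemma map_gsub {R : Type*} [CommRing R] [Algebra k R] (q : MvPolynomial (Fin 3) k)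
    (e : Fin 3 → R) :
    map ((aeval e : MvPolynomial (Fin 3) k →ₐ[k] R) : MvPolynomial (Fin 3) k →+* R) (gsub q) =
      rl q ![-e 1, e 0, 0] ![-e 2, 0, e 0] := by
  rw [gsub_eq, map_rl]
  congr 1 <;> ext i <;> fin_cases i <;> simp

lemma Sinv_map {R R' : Type*} [CommRing R] [CommRing R'] (φ : R →+* R') (f : Fin 5 → R) :
    φ (Sinv f) = Sinv (fun i => φ (f i)) := by
  simp [Sinv, map_ofNat]

lemma Tinv_map {R R' : Type*} [CommRing R] [CommRing R'] (φ : R →+* R') (f : Fin 5 → R) :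
    φ (Tinv f) = Tinv (fun i => φ (f i)) := by
  simp [Tinv, map_ofNat]

lemma binCoeff_scale {R : Type*} [CommRing R] [Algebra k R] (q : MvPolynomial (Fin 3) k)
    (hq : q.IsHomogeneous 4) (a b : Fin 3 → R) :
    subCoeff (binCoeff (rl q a b)) (crs a b 0) 0 0 (crs a b 0) =
    subCoeff (binCoeff (rl q ![-crs a b 1, crs a b 0, 0] ![-crs a b 2, 0, crs a b 0]))
      (a 1) (a 2) (b 1) (b 2) := by
  rw [← binCoeff_comp q hq, ← binCoeff_comp q hq]
  congr 2 <;> ext i <;> fin_cases i <;> simp [crs] <;> ring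

lemma S_domain {R : Type*} [CommRing R] [IsDomain R] [Algebra k R] (q : MvPolynomial (Fin 3) k)
    (hq : q.IsHomogeneous 4) (H : MvPolynomial (Fin 3) k) (hH : X 0 ^ 4 * H = SG q)
    (a b : Fin 3 → R) (hu : crs a b 0 ≠ 0) :
    aeval (crs a b) H = Sinv (binCoeff (rl q a b)) := by
  have h1 := congrArg Sinv (binCoeff_scale q hq a b)
  rw [Sinv_sub, Sinv_sub] at h1
  have h2 := congrArg (aeval (crs a b)) hH
  have h3 : aeval (crs a b) (SG q) = Sinv (binCoeff (rl q ![-crs a b 1, crs a b 0, 0]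
      ![-crs a b 2, 0, crs a b 0])) := by
    rw [← map_gsub, SG]
    refine (Sinv_map (aeval (crs a b) : MvPolynomial (Fin 3) k →ₐ[k] R).toRingHom _).trans ?_
    congr 1
  rw [h3] at h2
  rw [← h2] at h1
  simp only [map_mul, map_pow, aeval_X] at h1
  have h4 : a 1 * b 2 - b 1 * a 2 = crs a b 0 := by simp [crs]; ring
  rw [h4] at h1
  have h5 : crs a b 0 ^ 8 ≠ 0 := pow_ne_zero _ hu
  apply mul_left_cancel₀ h5
  linear_combination -h1

lemma T_domain {R : Type*} [CommRing R] [IsDomain R] [Algebra k R] (q : MvPolynomial (Fin 3) k)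
    (hq : q.IsHomogeneous 4) (K : MvPolynomial (Fin 3) k) (hK : X 0 ^ 6 * K = TG q)
    (a b : Fin 3 → R) (hu : crs a b 0 ≠ 0) :
    aeval (crs a b) K = Tinv (binCoeff (rl q a b)) := by
  have h1 := congrArg Tinv (binCoeff_scale q hq a b)
  rw [Tinv_sub, Tinv_sub] at h1
  have h2 := congrArg (aeval (crs a b)) hK
  have h3 : aeval (crs a b) (TG q) = Tinv (binCoeff (rl q ![-crs a b 1, crs a b 0, 0]
      ![-crs a b 2, 0, crs a b 0])) := by
    rw [← map_gsub, TG]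
    refine (Tinv_map (aeval (crs a b) : MvPolynomial (Fin 3) k →ₐ[k] R).toRingHom _).trans ?_
    congr 1
  rw [h3] at h2
  rw [← h2] at h1
  simp only [map_mul, map_pow, aeval_X] at h1
  have h4 : a 1 * b 2 - b 1 * a 2 = crs a b 0 := by simp [crs]; ring
  rw [h4] at h1
  have h5 : crs a b 0 ^ 12 ≠ 0 := pow_ne_zero _ hu
  apply mul_left_cancel₀ h5
  linear_combination -h1

/-- first generic point -/
def genA : Fin 3 → MvPolynomial (Fin 2 × Fin 3) k := fun i => X (0, i)

/-- second generic point -/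
def genB : Fin 3 → MvPolynomial (Fin 2 × Fin 3) k := fun i => X (1, i)

lemma gen_ne : crs (genA (k := k)) genB 0 ≠ 0 := by
  intro h
  have := congrArg (eval (fun x : Fin 2 × Fin 3 =>
    if x = (0, 1) then (1 : k) else if x = (1, 2) then 1 else 0)) h
  simp [crs, genA, genB] at this

lemma spec_crs {R : Type*} [CommRing R] [Algebra k R] (a b : Fin 3 → R)
    (F : MvPolynomial (Fin 3) k) :
    aeval (fun x : Fin 2 × Fin 3 => ![a, b] x.1 x.2) (aeval (crs (genA (k := k)) genB) F)
      = aeval (crs a b) F := by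
  rw [← AlgHom.comp_apply, comp_aeval]
  congr 2
  ext i
  fin_cases i <;> simp [crs, genA, genB]

lemma spec_rl {R : Type*} [CommRing R] [Algebra k R] (q : MvPolynomial (Fin 3) k)
    (a b : Fin 3 → R) (i : Fin 5) :
    (aeval (fun x : Fin 2 × Fin 3 => ![a, b] x.1 x.2) :
      MvPolynomial (Fin 2 × Fin 3) k →ₐ[k] R) (binCoeff (rl q (genA (k := k)) genB) i)
      = binCoeff (rl q a b) i := by
  refine (binCoeff_map ((aeval (fun x : Fin 2 × Fin 3 => ![a, b] x.1 x.2) :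
      MvPolynomial (Fin 2 × Fin 3) k →ₐ[k] R) : MvPolynomial (Fin 2 × Fin 3) k →+* R) _ _).symm.trans ?_
  rw [map_rl]
  simp [genA, genB]

lemma S_all {R : Type*} [CommRing R] [Algebra k R] (q : MvPolynomial (Fin 3) k)
    (hq : q.IsHomogeneous 4) (H : MvPolynomial (Fin 3) k) (hH : X 0 ^ 4 * H = SG q)
    (a b : Fin 3 → R) :
    aeval (crs a b) H = Sinv (binCoeff (rl q a b)) := by
  rw [← spec_crs, S_domain q hq H hH _ _ gen_ne]
  refine (Sinv_map ((aeval (fun x : Fin 2 × Fin 3 => ![a, b] x.1 x.2) :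
      MvPolynomial (Fin 2 × Fin 3) k →ₐ[k] R) : MvPolynomial (Fin 2 × Fin 3) k →+* R) _).trans ?_
  congr 1
  ext i
  exact spec_rl q a b i

lemma T_all {R : Type*} [CommRing R] [Algebra k R] (q : MvPolynomial (Fin 3) k)
    (hq : q.IsHomogeneous 4) (K : MvPolynomial (Fin 3) k) (hK : X 0 ^ 6 * K = TG q)
    (a b : Fin 3 → R) :
    aeval (crs a b) K = Tinv (binCoeff (rl q a b)) := by
  rw [← spec_crs, T_domain q hq K hK _ _ gen_ne]
  refine (Tinv_map ((aeval (fun x : Fin 2 × Fin 3 => ![a, b] x.1 x.2) :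
      MvPolynomial (Fin 2 × Fin 3) k →ₐ[k] R) : MvPolynomial (Fin 2 × Fin 3) k →+* R) _).trans ?_
  congr 1
  ext i
  exact spec_rl q a b i

lemma taylor {R : Type*} [CommRing R] [Algebra k R] (ε : R) (hε : ε * ε = 0)
    (a e : Fin 3 → R) (F : MvPolynomial (Fin 3) k) :
    aeval (fun i => a i + ε * e i) F =
      aeval a F + ε * ∑ i, e i * aeval a (pderiv i F) := by
  induction F using MvPolynomial.induction_on with
  | C c => simp
  | add p q hp hq =>
    simp only [map_add, hp, hq, mul_add, Finset.sum_add_distrib]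
    ring
  | mul_X p j hp =>
    simp only [map_mul, hp, aeval_X, Derivation.leibniz, map_add, smul_eq_mul, pderiv_X]
    simp only [Fin.sum_univ_three]
    fin_cases j
    · simp
      linear_combination (e 0 * aeval a (pderiv 0 p) + e 1 * aeval a (pderiv 1 p) +
        e 2 * aeval a (pderiv 2 p)) * e 0 * hε
    · simp
      linear_combination (e 0 * aeval a (pderiv 0 p) + e 1 * aeval a (pderiv 1 p) +
        e 2 * aeval a (pderiv 2 p)) * e 1 * hε
    · simp
      linear_combination (e 0 * aeval a (pderiv 0 p) + e 1 * aeval a (pderiv 1 p) +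
        e 2 * aeval a (pderiv 2 p)) * e 2 * hε

lemma fst_am {R : Type*} [CommRing R] (x : R) :
    TrivSqZeroExt.fst (algebraMap R (DualNumber R) x) = x := rfl

lemma snd_am {R : Type*} [CommRing R] (x : R) :
    TrivSqZeroExt.snd (algebraMap R (DualNumber R) x) = 0 := rfl

lemma Sinv_dual {R : Type*} [CommRing R] (ε m : R) (y : Fin 5 → R) (hε : ε * ε = 0)
    (f : Fin 5 → R) (hf : ∀ i, f i = (![0, 0, 0, m, 0] : Fin 5 → R) i + ε * y i) :
    Sinv f = ε * (-3 * m * y 1) := by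
  rw [Sinv, hf 0, hf 1, hf 2, hf 3, hf 4]
  simp
  linear_combination (12 * y 0 * y 4 - 3 * y 1 * y 3 + y 2 ^ 2) * hε

lemma Tinv_dual {R : Type*} [CommRing R] (ε m : R) (y : Fin 5 → R) (hε : ε * ε = 0)
    (f : Fin 5 → R) (hf : ∀ i, f i = (![0, 0, 0, m, 0] : Fin 5 → R) i + ε * y i) :
    Tinv f = ε * (-27 * m ^ 2 * y 0) := by
  rw [Tinv, hf 0, hf 1, hf 2, hf 3, hf 4]
  simp
  linear_combination (72 * ε * y 0 * y 2 * y 4 - 54 * y 0 * m * y 3 - 27 * ε * y 0 * y 3 ^ 2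
    - 27 * ε * y 1 ^ 2 * y 4 + 9 * y 1 * y 2 * (m + ε * y 3) - 2 * ε * y 2 ^ 3) * hε

lemma coeff01 {R : Type*} [CommRing R] [Algebra k R] (q : MvPolynomial (Fin 3) k)
    (hq : q.IsHomogeneous 4) (a b : Fin 3 → R) :
    binCoeff (rl q a b) 0 = aeval a q ∧
      binCoeff (rl q a b) 1 = ∑ i, b i * aeval a (pderiv i q) := by
  let ψ : MvPolynomial (Fin 2) R →ₐ[R] DualNumber R := aeval ![1, DualNumber.eps]
  have he : (DualNumber.eps : DualNumber R) * DualNumber.eps = 0 := DualNumber.eps_mul_eps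
  have h1 : ψ (rl q a b) = aeval (fun i => algebraMap R (DualNumber R) (a i) +
      DualNumber.eps * algebraMap R (DualNumber R) (b i)) q := by
    have : (ψ.restrictScalars k).comp
      (aeval (fun i => C (a i) * X 0 + C (b i) * X 1 : Fin 3 → MvPolynomial (Fin 2) R))
      = aeval (fun i => algebraMap R (DualNumber R) (a i) +
      DualNumber.eps * algebraMap R (DualNumber R) (b i)) := by
      ext i : 1
      simp only [AlgHom.comp_apply, aeval_X, AlgHom.restrictScalars_apply, ψ, map_add, map_mul,
        aeval_C, Matrix.cons_val_zero, Matrix.cons_val_one, mul_one]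
      ring
    exact DFunLike.congr_fun this q
  rw [taylor _ he] at h1
  have h2 : ψ (rl q a b) = algebraMap R (DualNumber R) (binCoeff (rl q a b) 0) +
      DualNumber.eps * algebraMap R (DualNumber R) (binCoeff (rl q a b) 1) := by
    conv_lhs => rw [eq_binQuartic _ (rl_homog q hq a b), binQuartic_expand]
    simp only [ψ, map_add, map_mul, map_pow, aeval_X,
        aeval_C, Matrix.cons_val_zero, Matrix.cons_val_one, mul_one, one_pow]
    linear_combination (algebraMap R (DualNumber R) (binCoeff (rl q a b) 2) +
      algebraMap R (DualNumber R) (binCoeff (rl q a b) 3) * DualNumber.eps +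
      algebraMap R (DualNumber R) (binCoeff (rl q a b) 4) * DualNumber.eps ^ 2) * he
  have h3 : ∀ F : MvPolynomial (Fin 3) k, aeval (fun i => algebraMap R (DualNumber R) (a i)) F =
      algebraMap R (DualNumber R) (aeval a F) := by
    intro F
    exact aeval_algebraMap_apply (DualNumber R) a F
  rw [h2] at h1
  simp only [h3, ← map_mul, ← map_sum] at h1
  constructor
  · have := congrArg TrivSqZeroExt.fst h1
    simpa only [TrivSqZeroExt.fst_add, TrivSqZeroExt.fst_mul, DualNumber.fst_eps, zero_mul,
      add_zero, fst_am] using this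
  · have := congrArg TrivSqZeroExt.snd h1
    simpa [-map_sum, -map_mul, -map_aeval, snd_am, fst_am] using this

lemma dual_rl_fst (q : MvPolynomial (Fin 3) k) (a b : Fin 3 → DualNumber k) (i : Fin 5) :
    (binCoeff (rl q a b) i).fst =
      binCoeff (rl q (fun i => (a i).fst) (fun i => (b i).fst)) i := by
  have h := map_rl (TrivSqZeroExt.fstHom k k k) q a b
  have h2 := congrArg (fun g => binCoeff g i) h
  simp only [binCoeff_map] at h2
  exact h2

lemma dual_taylor (a e : Fin 3 → k) (F : MvPolynomial (Fin 3) k) :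
    (aeval (fun i => algebraMap k (DualNumber k) (a i) +
      DualNumber.eps * algebraMap k (DualNumber k) (e i)) F).fst = eval a F ∧
    (aeval (fun i => algebraMap k (DualNumber k) (a i) +
      DualNumber.eps * algebraMap k (DualNumber k) (e i)) F).snd =
        ∑ i, e i * eval a (pderiv i F) := by
  have h3 : ∀ F : MvPolynomial (Fin 3) k, aeval (fun i => algebraMap k (DualNumber k) (a i)) F =
      algebraMap k (DualNumber k) (eval a F) := by
    intro F
    exact aeval_algebraMap_apply (DualNumber k) a F
  rw [taylor _ DualNumber.eps_mul_eps]
  simp only [h3, ← map_mul, ← map_sum]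
  simp [-map_sum, -map_mul, snd_am, fst_am]

/-- Core computation. -/
lemma core (q : MvPolynomial (Fin 3) k) (hq : q.IsHomogeneous 4) (h6 : (6 : k) ≠ 0)
    (H K : MvPolynomial (Fin 3) k)
    (hH : X 0 ^ 4 * H = SG q) (hK : X 0 ^ 6 * K = TG q)
    (p p' n : Fin 3 → k) (m : k) (hm : m ≠ 0)
    (hf : binCoeff (rl q p p') = ![0, 0, 0, m, 0])
    (hn : ∑ i, n i * eval p (pderiv i q) ≠ 0) :
    eval (crs p p') H = 0 ∧ eval (crs p p') K = 0 ∧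
      (∑ i, crs p n i * eval (crs p p') (pderiv i H)) ≠ 0 ∧
      (∑ i, crs p n i * eval (crs p p') (pderiv i K)) = 0 ∧
      (∑ i, crs n p' i * eval (crs p p') (pderiv i K)) ≠ 0 := by
  have h2 : (2 : k) ≠ 0 := fun h => h6 (by linear_combination 3 * h)
  have h3 : (3 : k) ≠ 0 := fun h => h6 (by linear_combination 2 * h)
  let ι := algebraMap k (DualNumber k)
  have hε : (DualNumber.eps : DualNumber k) * DualNumber.eps = 0 := DualNumber.eps_mul_eps
  have hA : crs (fun i => ι (p i)) (fun i => ι (p' i) + DualNumber.eps * ι (n i)) =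
      fun i => ι (crs p p' i) + DualNumber.eps * ι (crs p n i) := by
    ext1 i
    fin_cases i <;> simp [crs] <;> ring
  have hB : crs (fun i => ι (p i) + DualNumber.eps * ι (n i)) (fun i => ι (p' i)) =
      fun i => ι (crs p p' i) + DualNumber.eps * ι (crs n p' i) := by
    ext1 i
    fin_cases i <;> simp [crs] <;> ring
  -- coefficients in the two deformations
  set f := binCoeff (rl q (fun i => ι (p i)) (fun i => ι (p' i) + DualNumber.eps * ι (n i)))
    with hfdef
  set g := binCoeff (rl q (fun i => ι (p i) + DualNumber.eps * ι (n i)) (fun i => ι (p' i)))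
    with hgdef
  have ff : ∀ i, (f i).fst = (![0, 0, 0, m, 0] : Fin 5 → k) i := by
    intro i
    rw [hfdef, dual_rl_fst, ← hf]
    simp [ι, fst_am]
  have gf : ∀ i, (g i).fst = (![0, 0, 0, m, 0] : Fin 5 → k) i := by
    intro i
    rw [hgdef, dual_rl_fst, ← hf]
    simp [ι, fst_am]
  have e3 : ∀ F : MvPolynomial (Fin 3) k, aeval (fun i => ι (p i)) F = ι (eval p F) := by
    intro F
    exact aeval_algebraMap_apply (DualNumber k) p F
  have q0 : eval p q = 0 := by
    have := (coeff01 q hq p p').1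
    rw [hf] at this
    simpa [coe_aeval_eq_eval] using this.symm
  have f0 : (f 0).snd = 0 := by
    rw [hfdef, (coeff01 q hq _ _).1, e3, q0]
    simp
  have f1 : (f 1).snd = ∑ i, n i * eval p (pderiv i q) := by
    rw [hfdef, (coeff01 q hq _ _).2]
    simp only [e3]
    simp [ι, TrivSqZeroExt.snd_sum, fst_am, snd_am]
  have g0 : (g 0).snd = ∑ i, n i * eval p (pderiv i q) := by
    rw [hgdef, (coeff01 q hq _ _).1]
    exact (dual_taylor p n q).2
  have SA := S_all q hq H hH (fun i => ι (p i)) (fun i => ι (p' i) + DualNumber.eps * ι (n i))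
  have TA := T_all q hq K hK (fun i => ι (p i)) (fun i => ι (p' i) + DualNumber.eps * ι (n i))
  have TB := T_all q hq K hK (fun i => ι (p i) + DualNumber.eps * ι (n i)) (fun i => ι (p' i))
  rw [hA, ← hfdef] at SA TA
  rw [hB, ← hgdef] at TB
  have dec : ∀ f : Fin 5 → DualNumber k,
      (∀ i, (f i).fst = (![0, 0, 0, m, 0] : Fin 5 → k) i) →
      ∀ i, f i = (![0, 0, 0, ι m, 0] : Fin 5 → DualNumber k) i +
        DualNumber.eps * ι ((f i).snd) := by
    intro f hf i
    have := hf i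
    fin_cases i <;> ext <;> simp [ι, fst_am, snd_am] at this ⊢ <;> exact this
  have Sf := Sinv_dual _ _ _ hε f (dec f ff)
  have Tf := Tinv_dual _ _ _ hε f (dec f ff)
  have Tg := Tinv_dual _ _ _ hε g (dec g gf)
  have n3 : (-3 : DualNumber k) = ι (-3) := by simp [map_ofNat]
  have n27 : (-27 : DualNumber k) = ι (-27) := by simp [map_ofNat]
  simp only [n3, ← map_mul, ← map_pow] at Sf
  simp only [n27, ← map_mul, ← map_pow] at Tf Tg
  rw [Sf] at SA
  rw [Tf] at TA
  rw [Tg] at TB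
  have rS := dual_taylor (crs p p') (crs p n) H
  have rT := dual_taylor (crs p p') (crs p n) K
  have rU := dual_taylor (crs p p') (crs n p') K
  refine ⟨?_, ?_, ?_, ?_, ?_⟩
  · rw [← rS.1]
    refine (congrArg TrivSqZeroExt.fst SA).trans ?_
    simp
  · rw [← rT.1]
    refine (congrArg TrivSqZeroExt.fst TA).trans ?_
    simp
  · rw [← rS.2]
    intro h
    have := (congrArg TrivSqZeroExt.snd SA).symm.trans h
    rw [f1] at this
    simp only [TrivSqZeroExt.snd_mul, DualNumber.fst_eps, DualNumber.snd_eps, zero_smul, zero_add,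
      ι, fst_am, MulOpposite.op_one, one_smul, MulOpposite.smul_eq_mul_unop,
      MulOpposite.unop_op, one_mul] at this
    exact mul_ne_zero (mul_ne_zero (neg_ne_zero.mpr h3) hm) hn this
  · rw [← rT.2]
    refine (congrArg TrivSqZeroExt.snd TA).trans ?_
    simp [f0]
  · rw [← rU.2]
    intro h
    have := (congrArg TrivSqZeroExt.snd TB).symm.trans h
    have h27 : (27 : k) ≠ 0 := by
      have : (27 : k) = 3 ^ 3 := by norm_num
      rw [this]
      exact pow_ne_zero _ h3
    rw [g0] at this
    simp only [TrivSqZeroExt.snd_mul, DualNumber.fst_eps, DualNumber.snd_eps, zero_smul, zero_add,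
      ι, fst_am, MulOpposite.op_one, one_smul, MulOpposite.smul_eq_mul_unop,
      MulOpposite.unop_op, one_mul] at this
    exact mul_ne_zero (mul_ne_zero (neg_ne_zero.mpr h27) (pow_ne_zero 2 hm)) hn this

end Helpers

/-- If `ℓ` (with dual coordinates `d`) is a simple inflection line of a plane
quartic `{q = 0}` over an algebraically closed field of characteristic coprime to `6`, then the
harmonic quartic and the harmonic sextic both vanish at `d` and meet transversally there:
their gradients at `d` are linearly independent. -/
theorem stmt8 {k : Type*} [Field k] [IsAlgClosed k] (h6 : (6 : k) ≠ 0)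
    (q : MvPolynomial (Fin 3) k) (hq0 : q ≠ 0) (hq4 : q.IsHomogeneous 4)
    (d p : Fin 3 → k) (hd : IsSimpleInflectionLineAt q d p)
    (H K : MvPolynomial (Fin 3) k)
    (hH : X 0 ^ 4 * H = SG q) (hK : X 0 ^ 6 * K = TG q) :
    eval d H = 0 ∧ eval d K = 0 ∧
      LinearIndependent k
        ![(fun i => eval d (pderiv i H) : Fin 3 → k),
          (fun i => eval d (pderiv i K) : Fin 3 → k)] := by
  obtain ⟨hd0, a, b, s, t, hab, hda, hdb, hst, hp, hpq, ⟨j, hj⟩, L, M, hL, hM, hLM, hres, hLst⟩ := hd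
  obtain ⟨l0, l1, rfl⟩ := linear_eq L hL
  obtain ⟨m0, m1, rfl⟩ := linear_eq M hM
  simp at hLst
  -- the determinant
  have hμ : m0 * s + m1 * t ≠ 0 := by
    intro hμ
    have hΔ : l0 * m1 - l1 * m0 = 0 := by
      by_contra hΔ
      apply hst
      have h1 : (l0 * m1 - l1 * m0) * s = 0 := by linear_combination m1 * hLst - l1 * hμ
      have h2 : (l0 * m1 - l1 * m0) * t = 0 := by linear_combination l0 * hμ - m0 * hLst
      simp [hΔ] at h1 h2
      simp [h1, h2]
    rw [LinearIndependent.pair_iff] at hLM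
    have e0 := hLM m0 (-l0) (by
      simp only [smul_eq_C_mul, C_neg]
      have := congrArg (C (σ := Fin 2)) hΔ
      simp only [map_sub, map_mul, map_zero] at this
      linear_combination (-X 1) * this)
    have e1 := hLM m1 (-l1) (by
      simp only [smul_eq_C_mul, C_neg]
      have := congrArg (C (σ := Fin 2)) hΔ
      simp only [map_sub, map_mul, map_zero] at this
      linear_combination (X 0) * this)
    have e2 := hLM 0 1 (by simp [e0.1, e1.1])
    exact one_ne_zero e2.2
  have hΔ : l0 * m1 - l1 * m0 ≠ 0 := by
    intro hΔ
    have h1 : l0 * (m0 * s + m1 * t) = 0 := by linear_combination m0 * hLst + t * hΔ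
    have h2 : l1 * (m0 * s + m1 * t) = 0 := by linear_combination m1 * hLst - s * hΔ
    simp [hμ] at h1 h2
    rw [LinearIndependent.pair_iff] at hLM
    have e2 := hLM 1 0 (by simp [h1, h2])
    exact one_ne_zero e2.1
  -- the cross product is proportional to d
  have hcr : crs a b ≠ 0 := by
    have := crossProduct_ne_zero_iff_linearIndependent.mpr hab
    rwa [cross_apply] at this
  obtain ⟨c, hc⟩ : ∃ c : k, ∀ i, d i = c * crs a b i := by
    obtain ⟨i0, hi0⟩ := Function.ne_iff.mp hcr
    simp only [Pi.zero_apply] at hi0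
    refine ⟨d i0 / crs a b i0, fun i => ?_⟩
    rw [div_mul_eq_mul_div, eq_div_iff hi0]
    simp only [dot3] at hda hdb
    have h01 : d 0 * crs a b 1 = d 1 * crs a b 0 := by
      simp [crs]
      linear_combination a 2 * hdb - b 2 * hda
    have h12 : d 1 * crs a b 2 = d 2 * crs a b 1 := by
      simp [crs]
      linear_combination a 0 * hdb - b 0 * hda
    have h20 : d 2 * crs a b 0 = d 0 * crs a b 2 := by
      simp [crs]
      linear_combination a 1 * hdb - b 1 * hda
    fin_cases i0 <;> fin_cases i <;>
      first
        | rfl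
        | exact h01
        | exact h12
        | exact h20
        | exact h01.symm
        | exact h12.symm
        | exact h20.symm
  have hc0 : c ≠ 0 := by
    rintro rfl
    apply hd0
    ext i
    simp [hc]
  -- the second point
  set e : k := -c / (m0 * s + m1 * t) with he
  have he0 : e ≠ 0 := div_ne_zero (neg_ne_zero.mpr hc0) hμ
  have heμ : e * (m0 * s + m1 * t) = -c := div_mul_cancel₀ _ hμ
  obtain rfl : p = fun i => s * a i + t * b i := funext hp
  have hdc : crs (fun i => s * a i + t * b i)
      (fun i => (e * m1) * a i + (-(e * m0)) * b i) = d := by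
    ext i
    rw [hc]
    fin_cases i <;> simp [crs]
    · linear_combination (-(a 1 * b 2 - a 2 * b 1)) * heμ
    · linear_combination (-(a 2 * b 0 - a 0 * b 2)) * heμ
    · linear_combination (-(a 0 * b 1 - a 1 * b 0)) * heμ
  have hf : binCoeff (rl q (fun i => s * a i + t * b i)
      (fun i => (e * m1) * a i + (-(e * m0)) * b i)) =
      ![0, 0, 0, (e * (l0 * m1 - l1 * m0)) ^ 3 * (m0 * s + m1 * t), 0] := by
    have h1 : rl q (fun i => s * a i + t * b i)
      (fun i => (e * m1) * a i + (-(e * m0)) * b i) =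
      binQuartic ![0, 0, 0, (e * (l0 * m1 - l1 * m0)) ^ 3 * (m0 * s + m1 * t), 0] := by
      rw [rl_comp]
      have h2 : rl q a b = (C l0 * X 0 + C l1 * X 1) ^ 3 * (C m0 * X 0 + C m1 * X 1) := hres
      rw [h2, binQuartic_expand]
      have h3 := congrArg (C (σ := Fin 2)) hLst
      simp only [map_add, map_mul, map_zero] at h3
      have h4 : (C l0 * (C s * X 0 + C (e * m1) * X 1) + C l1 * (C t * X 0 + C (-(e * m0)) * X 1)
          : MvPolynomial (Fin 2) k) = C (e * (l0 * m1 - l1 * m0)) * X 1 := by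
        simp only [map_neg, map_mul, map_sub]
        linear_combination X 0 * h3
      have h5 : (C m0 * (C s * X 0 + C (e * m1) * X 1) + C m1 * (C t * X 0 + C (-(e * m0)) * X 1)
          : MvPolynomial (Fin 2) k) = C (m0 * s + m1 * t) * X 0 := by
        simp only [map_neg, map_mul, map_add]
        ring
      simp only [map_mul, map_pow, map_add, aeval_X, aeval_C, algebraMap_eq,
        Matrix.cons_val_zero, Matrix.cons_val_one]
      simp only [← C_mul] 
      rw [h4, h5]
      simp
      ring
    rw [h1]
    ext1 i
    rw [binCoeff_binQuartic]
  obtain ⟨r1, r2, r3, r4, r5⟩ := core q hq4 h6 H K hH hK _ _ (Pi.single j 1) _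
    (mul_ne_zero (pow_ne_zero 3 (mul_ne_zero he0 hΔ)) hμ) hf (by
      simpa [Pi.single_apply] using hj)
  rw [hdc] at r1 r2 r3 r4 r5
  refine ⟨r1, r2, ?_⟩
  rw [LinearIndependent.pair_iff]
  intro α β hαβ
  have hi : ∀ i, α * eval d (pderiv i H) + β * eval d (pderiv i K) = 0 := fun i => by
    simpa using congrFun hαβ i
  have hsum : ∀ v : Fin 3 → k, α * (∑ i, v i * eval d (pderiv i H)) +
      β * (∑ i, v i * eval d (pderiv i K)) = 0 := by
    intro v
    rw [Finset.mul_sum, Finset.mul_sum, ← Finset.sum_add_distrib]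
    apply Finset.sum_eq_zero
    intro i _
    linear_combination v i * hi i
  have hα : α = 0 := by
    have := hsum (crs (fun i => s * a i + t * b i) (Pi.single j 1))
    rw [r4, mul_zero, add_zero] at this
    exact (mul_eq_zero.mp this).resolve_right r3
  refine ⟨hα, ?_⟩
  have := hsum (crs (Pi.single j 1) (fun i => (e * m1) * a i + (-(e * m0)) * b i))
  rw [hα, zero_mul, zero_add] at this
  exact (mul_eq_zero.mp this).resolve_right r5
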